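/- Let 2 ≤ k ≤ n, let α₁, …, α_{2n−2k} be differential 1-forms on M linearly independent at every point of an open dense subset of M, and let ω₀ be an almost symplectic structure on M such that f = ⟨α₁∧⋯∧α_{2n−2k}, Λ₀^{n−k}/(n−k)!⟩ is nonvanishing on an open dense subset U of M. Set X_{α_i} = Λ₀^#(α_i), let σ be a 2-form on M with σ(X_{α_i},·) = 0 for all i and of rank 2k at every point of U, set Λ = Λ₀^#(σ) and g = i_{Λ₀}σ. Then Λ is a bivector field of rank at most 2k with Λ(α_i,·) = 0 for all i, at every point of U the kernel of the map β ↦ Λ(β,·) is exactly the span of α₁,…,α_{2n−2k}, and the bracket {h₁,h₂} = Λ(dh₁,dh₂) satisfies, at every point of U, {h₁,h₂}·Ω = −(1/f) dh₁∧dh₂∧(σ + (g/(k−1))ω₀)∧(ω₀^{k−2}/(k−2)!)∧α₁∧⋯∧α_{2n−2k} for all smooth h₁,h₂. -/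

import Mathlib

namespace Damianou

noncomputable section

/-- Points of `ℝ^N`. -/
abbrev Pt (N : ℕ) := Fin N → ℝ

/-- Raw coordinate representation of a differential `p`-form (or, dually, of a
`p`-vector field): to each point we assign the array of its components. -/
abbrev Form (N p : ℕ) := Pt N → (Fin p → Fin N) → ℝ

/-- The component array of an alternating (antisymmetric) tensor. -/
def AltArr {N p : ℕ} (f : (Fin p → Fin N) → ℝ) : Prop :=
  (∀ (I : Fin p → Fin N) (σ : Equiv.Perm (Fin p)),
      f (I ∘ σ) = ((Equiv.Perm.sign σ : ℤ) : ℝ) * f I) ∧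
  ∀ I : Fin p → Fin N, ¬ Function.Injective I → f I = 0

/-- `ω` is a (smooth) differential `p`-form on the set `M`. -/
def IsFormOn {N p : ℕ} (ω : Form N p) (M : Set (Pt N)) : Prop :=
  (∀ x ∈ M, AltArr (ω x)) ∧ ∀ I, ContDiffOn ℝ (⊤ : ℕ∞) (fun x => ω x I) M

/-- The pairing `⟨η, P⟩` of a `p`-form with a `p`-vector field, determined by
`⟨η₁∧⋯∧η_p, X₁∧⋯∧X_p⟩ = det (⟨η_i, X_j⟩)`. -/
def pairF {N p : ℕ} (η P : Form N p) : Pt N → ℝ :=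
  fun x => (p.factorial : ℝ)⁻¹ * ∑ I : Fin p → Fin N, η x I * P x I

/-- Wedge product (determinant convention). -/
def wedgeF {N : ℕ} (p q : ℕ) (ω : Form N p) (η : Form N q) : Form N (p + q) :=
  fun x I => ((p.factorial : ℝ) * (q.factorial : ℝ))⁻¹ *
    ∑ σ : Equiv.Perm (Fin (p + q)), ((Equiv.Perm.sign σ : ℤ) : ℝ) *
      (ω x fun i => I (σ (Fin.castAdd q i))) * (η x fun j => I (σ (Fin.natAdd p j)))

def smulF {N p : ℕ} (c : ℝ) (ω : Form N p) : Form N p := fun x I => c * ω x I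
def fsmulF {N p : ℕ} (c : Pt N → ℝ) (ω : Form N p) : Form N p := fun x I => c x * ω x I
def addF {N p : ℕ} (ω η : Form N p) : Form N p := fun x I => ω x I + η x I
def subF {N p : ℕ} (ω η : Form N p) : Form N p := fun x I => ω x I - η x I

/-- Cast between (propositionally) equal degrees. -/
def castF {N p q : ℕ} (h : p = q) (ω : Form N p) : Form N q :=
  fun x J => ω x fun t => J (Fin.cast h t)

/-- Total cast, defaulting to `0` when the degrees differ. -/
def castT {N p q : ℕ} (ω : Form N p) : Form N q :=
  if h : p = q then castF h ω else fun _ _ => 0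

/-- Partial derivative `∂f/∂x_i`. -/
def pd {N : ℕ} (f : Pt N → ℝ) (i : Fin N) (x : Pt N) : ℝ :=
  fderiv ℝ f x (Pi.single i 1)

/-- The gradient covector of a function. -/
def grad {N : ℕ} (f : Pt N → ℝ) (x : Pt N) : Fin N → ℝ := fun i => pd f i x

/-- The differential of a function, as a `1`-form. -/
def dF {N : ℕ} (f : Pt N → ℝ) : Form N 1 := fun x I => pd f (I 0) x

/-- Exterior derivative. -/
def extd {N p : ℕ} (ω : Form N p) : Form N (p + 1) :=
  fun x I => ∑ i : Fin (p + 1), (-1 : ℝ) ^ (i : ℕ) *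
    fderiv ℝ (fun y => ω y fun j => I (i.succAbove j)) x (Pi.single (I i) 1)

/-- Concatenation of index blocks of lengths `a` and `b - a` into `Fin b`. -/
def catIdx {N a b : ℕ} (u : Fin a → Fin N) (v : Fin (b - a) → Fin N) : Fin b → Fin N :=
  fun t => if h : (t : ℕ) < a then u ⟨t, h⟩
    else v ⟨(t : ℕ) - a, by have := t.isLt; omega⟩

/-- Concatenation of index blocks of lengths `b - c` and `c` into `Fin b`. -/
def catIdx' {N c b : ℕ} (u : Fin (b - c) → Fin N) (v : Fin c → Fin N) : Fin b → Fin N :=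
  fun t => if h : (t : ℕ) < b - c then u ⟨t, h⟩
    else v ⟨(t : ℕ) - (b - c), by have := t.isLt; omega⟩

/-- Interior product `i_P η` of a `q`-form `η` by a `p`-vector field `P`;
it satisfies `⟨i_P η, Q⟩ = (-1)^{p(p-1)/2} ⟨η, P ∧ Q⟩`. -/
def iF {N : ℕ} (p q : ℕ) (P : Form N p) (η : Form N q) : Form N (q - p) :=
  fun x J => (-1 : ℝ) ^ (p * (p - 1) / 2) * (p.factorial : ℝ)⁻¹ *
    ∑ I : Fin p → Fin N, P x I * η x (catIdx I J)

/-- Interior product `j_η P` of an `r`-vector field `P` by a `q`-form `η`;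
it satisfies `⟨ζ, j_η P⟩ = ⟨ζ ∧ η, P⟩`. -/
def jF {N : ℕ} (q r : ℕ) (η : Form N q) (P : Form N r) : Form N (r - q) :=
  fun x B => (q.factorial : ℝ)⁻¹ * ∑ A : Fin q → Fin N, η x A * P x (catIdx' B A)

/-- The extension of `Λ₀^#` to `p`-forms:
`Λ₀^#(ζ)(α₁,…,α_p) = (-1)^p ζ(Λ₀^#(α₁),…,Λ₀^#(α_p))`, in coordinates. -/
def sharpF {N : ℕ} (Λ : Form N 2) (p : ℕ) (ζ : Form N p) : Form N p :=
  fun x J => (-1 : ℝ) ^ p * ∑ I : Fin p → Fin N, ζ x I * ∏ t, Λ x ![I t, J t]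

/-- `Λ^#` applied to a covector: `⟨β, Λ^#(α)⟩ = Λ(α,β)`. -/
def sharpV {N : ℕ} (Λ : Form N 2) (α : Fin N → ℝ) (x : Pt N) : Fin N → ℝ :=
  fun j => ∑ i, Λ x ![i, j] * α i

/-- The hamiltonian vector field `X_f = Λ₀^#(df)`. -/
def hamV {N : ℕ} (Λ : Form N 2) (f : Pt N → ℝ) (x : Pt N) : Fin N → ℝ :=
  sharpV Λ (grad f x) x

/-- Coefficient matrix of a 2-form (or of a bivector field) at a point. -/
def mat2 {N : ℕ} (ω : Form N 2) (x : Pt N) : Matrix (Fin N) (Fin N) ℝ :=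
  Matrix.of fun i j => ω x ![i, j]

/-- The bracket `{g,h} = Λ(dg,dh)` associated with a bivector field. -/
def braF {N : ℕ} (Λ : Form N 2) (g h : Pt N → ℝ) : Pt N → ℝ :=
  fun x => ∑ i, ∑ j, Λ x ![i, j] * pd g i x * pd h j x

/-- The Jacobi identity for the bracket of `Λ`, for all functions smooth on `M`. -/
def JacobiOn {N : ℕ} (Λ : Form N 2) (M : Set (Pt N)) : Prop :=
  ∀ g h k : Pt N → ℝ, ContDiffOn ℝ (⊤ : ℕ∞) g M → ContDiffOn ℝ (⊤ : ℕ∞) h M →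
    ContDiffOn ℝ (⊤ : ℕ∞) k M →
    ∀ x ∈ M, braF Λ g (braF Λ h k) x + braF Λ h (braF Λ k g) x + braF Λ k (braF Λ g h) x = 0

/-- `f` is a Casimir of `Λ` on `M`, i.e. `Λ(df,·) = 0` on `M`. -/
def CasimirOn {N : ℕ} (Λ : Form N 2) (f : Pt N → ℝ) (M : Set (Pt N)) : Prop :=
  ∀ x ∈ M, ∀ b, ∑ a, Λ x ![a, b] * grad f x a = 0

/-- Wedge powers of a `2`-form (or of a bivector field). -/
def wpow {N : ℕ} (ω : Form N 2) : (m : ℕ) → Form N (2 * m)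
  | 0 => fun _ _ => 1
  | m + 1 => wedgeF (2 * m) 2 (wpow ω m) ω

/-- The wedge `α₁ ∧ ⋯ ∧ α_m` of a family of `1`-forms. -/
def wedgeList {N : ℕ} : (m : ℕ) → (Fin m → Form N 1) → Form N m
  | 0, _ => fun _ _ => 1
  | m + 1, α => wedgeF m 1 (wedgeList m fun i => α i.castSucc) (α (Fin.last m))

/-- `ω₀` is an almost symplectic structure on `M` with associated (nondegenerate)
bivector field `Λ₀`:  `Λ₀^#` is the inverse of `X ↦ -ω₀(X,·)`, which in coordinates
reads `(mat2 ω₀ x) * (mat2 Λ₀ x) = -1`. -/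
def AlmostSymp {N : ℕ} (ω₀ Λ₀ : Form N 2) (M : Set (Pt N)) : Prop :=
  IsFormOn ω₀ M ∧ IsFormOn Λ₀ M ∧ ∀ x ∈ M, mat2 ω₀ x * mat2 Λ₀ x = -1

/-- `ωⁿ/n!`; for an almost symplectic `ω₀` on `ℝ^{2n}` this is the volume form `Ω`,
and for `Λ₀` it is the dual `2n`-vector field `Ω̃`. -/
def volF {N : ℕ} (n : ℕ) (ω : Form N 2) : Form N (2 * n) :=
  smulF ((n.factorial : ℝ)⁻¹) (wpow ω n)

/-- The adjoint `*φ = (-1)^{p(p-1)/2} i_{Λ₀^#(φ)} (ω₀ⁿ/n!)` of a `p`-form. -/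
def adjF {n : ℕ} (ω₀ Λ₀ : Form (2 * n) 2) (p : ℕ) (φ : Form (2 * n) p) :
    Form (2 * n) (2 * n - p) :=
  smulF ((-1 : ℝ) ^ (p * (p - 1) / 2)) (iF p (2 * n) (sharpF Λ₀ p φ) (volF n ω₀))

/-- The codifferential `δ = * ∘ d ∘ *`. -/
def codiffF {n : ℕ} (ω₀ Λ₀ : Form (2 * n) 2) (p : ℕ) (φ : Form (2 * n) p) :
    Form (2 * n) (p - 1) :=
  castT (adjF ω₀ Λ₀ (2 * n - p + 1) (extd (adjF ω₀ Λ₀ p φ)))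

/-- The compatibility condition `2 σ ∧ δ(σ) = δ(σ ∧ σ)` on `M`. -/
def DeltaCond {n : ℕ} (ω₀ Λ₀ σ : Form (2 * n) 2) (M : Set (Pt (2 * n))) : Prop :=
  ∀ x ∈ M, ∀ I : Fin 3 → Fin (2 * n),
    smulF 2 (wedgeF 2 1 σ (codiffF ω₀ Λ₀ 2 σ)) x I = codiffF ω₀ Λ₀ 4 (wedgeF 2 2 σ σ) x I

/-!
STATEMENT 8.  Almost Poisson brackets with prescribed kernel:  for `1`-forms
`α₁,…,α_{2(n-k)}` (in place of exact differentials), the bivector field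
`Λ = Λ₀^#(σ)` has rank at most `2k`, kernel exactly spanned by the `α_i` on
`U`, and its bracket is given by formula (14).
-/

/-- `f = ⟨α₁∧⋯∧α_{2(n-k)}, Λ₀^{n-k}/(n-k)!⟩`. -/
def fAlpha {n k : ℕ} (Λ₀ : Form (2 * n) 2) (α : Fin (2 * (n - k)) → Form (2 * n) 1) :
    Pt (2 * n) → ℝ :=
  pairF (wedgeList (2 * (n - k)) α)
    (smulF (((n - k).factorial : ℝ)⁻¹) (wpow Λ₀ (n - k)))

/-- `g = i_{Λ₀}σ = -⟨σ,Λ₀⟩`. -/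
def gEven {N : ℕ} (Λ₀ σ : Form N 2) : Pt N → ℝ := fun x => -(pairF σ Λ₀ x)

/-- The covector of a `1`-form at a point. -/
def cov1 {N : ℕ} (α : Form N 1) (x : Pt N) : Fin N → ℝ := fun i => α x fun _ => i

/-- The core `(2n-2)`-form `(σ + (g/(k-1))ω₀)∧(ω₀^{k-2}/(k-2)!)∧α₁∧⋯∧α_{2(n-k)}`. -/
def coreFormA {n : ℕ} (k : ℕ) (ω₀ Λ₀ σ : Form (2 * n) 2)
    (α : Fin (2 * (n - k)) → Form (2 * n) 1) :
    Form (2 * n) (2 + 2 * (k - 2) + 2 * (n - k)) :=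
  wedgeF (2 + 2 * (k - 2)) (2 * (n - k))
    (wedgeF 2 (2 * (k - 2))
      (addF σ (fsmulF (fun x => gEven Λ₀ σ x / ((k : ℝ) - 1)) ω₀))
      (smulF (((k - 2).factorial : ℝ)⁻¹) (wpow ω₀ (k - 2))))
    (wedgeList (2 * (n - k)) α)

/-- The exterior algebra of the space of covectors of `ℝ^N`. -/
abbrev Ext (N : ℕ) := ExteriorAlgebra ℝ (Fin N → ℝ)

/-- A covector as an element of the exterior algebra. -/
abbrev covec {N : ℕ} (v : Fin N → ℝ) : Ext N := ExteriorAlgebra.ι ℝ v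

/-- The element of the exterior algebra with component array `f`. -/
def toExt {N : ℕ} (p : ℕ) (f : (Fin p → Fin N) → ℝ) : Ext N :=
  (p.factorial : ℝ)⁻¹ • ∑ I : Fin p → Fin N,
    f I • ExteriorAlgebra.ιMulti ℝ p fun i => (Pi.single (I i) 1 : Fin N → ℝ)

/-- Contraction by a constant vector. -/
def ctr {N : ℕ} (X : Fin N → ℝ) : Ext N →ₗ[ℝ] Ext N :=
  CliffordAlgebra.contractLeft (dotProductEquiv ℝ (Fin N) X)

/-- Arrays transforming by the sign under permutation of indices. -/
def Skew {N p : ℕ} (f : (Fin p → Fin N) → ℝ) : Prop :=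
  ∀ (I : Fin p → Fin N) (τ : Equiv.Perm (Fin p)),
    f (I ∘ τ) = ((Equiv.Perm.sign τ : ℤ) : ℝ) * f I

lemma ctr_covec_mul {N : ℕ} (X v : Fin N → ℝ) (y : Ext N) :
    ctr X (covec v * y) = (X ⬝ᵥ v) • y - covec v * ctr X y := by
  simp [ctr, CliffordAlgebra.contractLeft_ι_mul]

lemma ctr_one {N : ℕ} (X : Fin N → ℝ) : ctr X 1 = 0 := by
  simp [ctr]

lemma covec_mul_covec {N : ℕ} (u v : Fin N → ℝ) :
    covec u * covec v = -(covec v * covec u) :=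
  eq_neg_of_add_eq_zero_left (ExteriorAlgebra.ι_add_mul_swap u v)

lemma Skew.curry {N p : ℕ} {F : (Fin (p + 1) → Fin N) → ℝ} (hF : Skew F) (a : Fin N) :
    Skew fun J : Fin p → Fin N => F (Fin.cons a J) := by
  intro J τ
  have h := hF (Fin.cons a J) (Equiv.Perm.decomposeFin.symm (0, τ))
  rw [Equiv.Perm.decomposeFin.symm_sign] at h
  simp only [if_true, one_mul] at h
  rw [← h]
  refine congrArg F (funext fun i => ?_)
  refine Fin.cases ?_ (fun j => ?_) i <;> simp

lemma Skew.swap {N p : ℕ} {F : (Fin (p + 2) → Fin N) → ℝ} (hF : Skew F) (a b : Fin N)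
    (J : Fin p → Fin N) :
    F (Fin.cons a (Fin.cons b J)) = -F (Fin.cons b (Fin.cons a J)) := by
  have h := hF (Fin.cons b (Fin.cons a J)) (Equiv.swap 0 1)
  rw [Equiv.Perm.sign_swap (by simp)] at h
  have e : (Fin.cons b (Fin.cons a J : Fin (p + 1) → Fin N) : Fin (p + 2) → Fin N) ∘
      (Equiv.swap 0 1) = Fin.cons a (Fin.cons b J : Fin (p + 1) → Fin N) := by
    ext i
    refine Fin.cases ?_ (fun j => Fin.cases ?_ (fun l => ?_) j) i
    · simp
    · simp
    · have : (Equiv.swap (0 : Fin (p + 2)) 1) l.succ.succ = l.succ.succ :=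
        Equiv.swap_apply_of_ne_of_ne (Fin.succ_ne_zero _)
          (by rw [← Fin.succ_zero_eq_one, Ne, Fin.succ_inj]; exact Fin.succ_ne_zero _)
      simp [this]
  rw [e] at h
  simpa using h

lemma toExt_succ {N p : ℕ} (F : (Fin (p + 1) → Fin N) → ℝ) :
    ((p + 1 : ℕ) : ℝ) • toExt (p + 1) F =
      ∑ a, covec (Pi.single a 1) * toExt p fun J => F (Fin.cons a J) := by
  have hsum : ∑ I : Fin (p + 1) → Fin N, F I • ExteriorAlgebra.ιMulti ℝ (p + 1)
      (fun i => (Pi.single (I i) 1 : Fin N → ℝ)) =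
      ∑ a, ∑ J : Fin p → Fin N, F (Fin.cons a J) • (covec (Pi.single a 1) *
        ExteriorAlgebra.ιMulti ℝ p (fun i => (Pi.single (J i) 1 : Fin N → ℝ))) := by
    rw [← (Fin.consEquiv fun _ => Fin N).sum_comp, Fintype.sum_prod_type]
    refine Finset.sum_congr rfl fun a _ => Finset.sum_congr rfl fun J _ => ?_
    rw [ExteriorAlgebra.ιMulti_succ_apply]
    simp [Fin.consEquiv, Matrix.vecTail, Function.comp_def]
  rw [toExt, hsum, smul_smul, Nat.factorial_succ]
  simp only [toExt, mul_smul_comm, Finset.mul_sum, Finset.smul_sum]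
  refine Finset.sum_congr rfl fun a _ => Finset.sum_congr rfl fun J _ => ?_
  congr 1
  have : ((p + 1 : ℕ) : ℝ) ≠ 0 := by positivity
  have : (p.factorial : ℝ) ≠ 0 := by positivity
  push_cast at *
  field_simp

lemma toExt_neg {N p : ℕ} (F : (Fin p → Fin N) → ℝ) :
    toExt p (fun I => -F I) = -toExt p F := by
  simp [toExt]

lemma succ_smul_ctr_toExt {N p : ℕ} (F : (Fin (p + 1) → Fin N) → ℝ) (b : Fin N) :
    ((p + 1 : ℕ) : ℝ) • ctr (Pi.single b 1) (toExt (p + 1) F) =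
      toExt p (fun J => F (Fin.cons b J)) - ∑ a, covec (Pi.single a 1) *
        ctr (Pi.single b 1) (toExt p fun J => F (Fin.cons a J)) := by
  rw [← map_smul, toExt_succ, map_sum]
  simp only [ctr_covec_mul, Finset.sum_sub_distrib]
  congr 1
  simp [Pi.single_apply]

lemma ctr_toExt {N p : ℕ} {F : (Fin (p + 1) → Fin N) → ℝ} (hF : Skew F) (b : Fin N) :
    ctr (Pi.single b 1) (toExt (p + 1) F) = toExt p fun J => F (Fin.cons b J) := by
  induction p with
  | zero =>
    have h := succ_smul_ctr_toExt F b
    have h0 : ∀ f : (Fin 0 → Fin N) → ℝ, ctr (Pi.single b 1) (toExt 0 f) = 0 := by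
      intro f
      simp [toExt, ctr_one]
    simpa [h0] using h
  | succ p ih =>
    have hp : ((p + 1 + 1 : ℕ) : ℝ) ≠ 0 := by positivity
    have h3 : ∑ a, covec (Pi.single a 1) * ctr (Pi.single b 1)
        (toExt (p + 1) fun J => F (Fin.cons a J)) =
        -(((p + 1 : ℕ) : ℝ) • toExt (p + 1) fun J => F (Fin.cons b J)) := by
      rw [toExt_succ, ← Finset.sum_neg_distrib]
      refine Finset.sum_congr rfl fun a _ => ?_
      rw [ih (hF.curry a), ← mul_neg, ← toExt_neg]
      congr 2
      funext J
      exact hF.swap a b J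
    have h := succ_smul_ctr_toExt F b
    rw [h3, sub_neg_eq_add, Nat.cast_succ (p + 1), add_comm _ (1 : ℝ), add_smul (1 : ℝ),
      ← one_smul ℝ (toExt (p + 1) fun J => F (Fin.cons b J)), smul_smul, ← add_smul,
      ← add_smul, mul_one] at h
    exact smul_right_injective _ (by positivity : (1 : ℝ) + ((p + 1 : ℕ) : ℝ) ≠ 0) h

lemma toExt_injective {N p : ℕ} {F G : (Fin p → Fin N) → ℝ} (hF : Skew F) (hG : Skew G)
    (h : toExt p F = toExt p G) : F = G := by
  induction p with
  | zero =>
    ext I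
    have h' := congrArg ExteriorAlgebra.algebraMapInv h
    simpa [toExt, Subsingleton.elim I default] using h'
  | succ p ih =>
    ext I
    have h' := ih (hF.curry (I 0)) (hG.curry (I 0))
      (by rw [← ctr_toExt hF, ← ctr_toExt hG, h])
    have := congrFun h' (Fin.tail I)
    simpa using this

lemma ιMulti_single_perm {N p : ℕ} (I : Fin p → Fin N) (τ : Equiv.Perm (Fin p)) :
    ExteriorAlgebra.ιMulti ℝ p (fun i => (Pi.single ((I ∘ τ) i) 1 : Fin N → ℝ)) =
      ((Equiv.Perm.sign τ : ℤ) : ℝ) •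
        ExteriorAlgebra.ιMulti ℝ p fun i => (Pi.single (I i) 1 : Fin N → ℝ) := by
  have := (ExteriorAlgebra.ιMulti ℝ p).map_perm
    (fun i => (Pi.single (I i) 1 : Fin N → ℝ)) τ
  rw [Int.cast_smul_eq_zsmul]
  exact this

lemma sign_mul_self {p : ℕ} (τ : Equiv.Perm (Fin p)) :
    ((Equiv.Perm.sign τ : ℤ) : ℝ) * ((Equiv.Perm.sign τ : ℤ) : ℝ) = 1 := by
  rcases Int.units_eq_one_or (Equiv.Perm.sign τ) with h | h <;> simp [h]

/-- Summing an antisymmetrized array against an array with sign symmetry. -/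
lemma sum_antisymm {V : Type*} [AddCommGroup V] [Module ℝ V] {N p : ℕ}
    (E : (Fin p → Fin N) → V)
    (hE : ∀ I (τ : Equiv.Perm (Fin p)), E (I ∘ τ) = ((Equiv.Perm.sign τ : ℤ) : ℝ) • E I)
    (f : (Fin p → Fin N) → ℝ) :
    ∑ I : Fin p → Fin N, (∑ τ : Equiv.Perm (Fin p),
      ((Equiv.Perm.sign τ : ℤ) : ℝ) * f (I ∘ τ)) • E I =
      (p.factorial : ℝ) • ∑ I : Fin p → Fin N, f I • E I := by
  simp only [Finset.sum_smul]
  rw [Finset.sum_comm]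
  have h : ∀ τ : Equiv.Perm (Fin p), ∑ I : Fin p → Fin N,
      (((Equiv.Perm.sign τ : ℤ) : ℝ) * f (I ∘ τ)) • E I = ∑ I : Fin p → Fin N, f I • E I := by
    intro τ
    rw [← (τ.arrowCongr (Equiv.refl (Fin N))).symm.sum_comp fun I => f I • E I]
    refine Finset.sum_congr rfl fun I _ => ?_
    have e : (τ.arrowCongr (Equiv.refl (Fin N))).symm I = I ∘ τ := rfl
    rw [e, hE, smul_smul, mul_comm]
  simp [h, Finset.card_univ, Fintype.card_perm, ← Nat.cast_smul_eq_nsmul ℝ]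

lemma sum_append {V : Type*} [AddCommMonoid V] {N p q : ℕ} (f : (Fin (p + q) → Fin N) → V) :
    ∑ I, f I = ∑ J : Fin p → Fin N, ∑ K : Fin q → Fin N, f (Fin.append J K) := by
  rw [← (Fin.appendEquiv p q).sum_comp, Fintype.sum_prod_type]
  rfl

lemma toExt_wedgeF {N p q : ℕ} (ω : Form N p) (η : Form N q) (x : Pt N) :
    toExt (p + q) (wedgeF p q ω η x) = toExt p (ω x) * toExt q (η x) := by
  have h := sum_antisymm
    (fun I : Fin (p + q) → Fin N =>
      ExteriorAlgebra.ιMulti ℝ (p + q) fun i => (Pi.single (I i) 1 : Fin N → ℝ))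
    ιMulti_single_perm
    (fun I => (ω x fun i => I (Fin.castAdd q i)) * (η x fun j => I (Fin.natAdd p j)))
  simp only [Function.comp_apply, ← mul_assoc] at h
  simp only [toExt, wedgeF, mul_smul, ← Finset.smul_sum]
  rw [h, sum_append]
  simp only [Fin.append_left, Fin.append_right]
  have hJK : ∀ (J : Fin p → Fin N) (K : Fin q → Fin N),
      (ExteriorAlgebra.ιMulti ℝ (p + q) fun i => (Pi.single (Fin.append J K i) 1 : Fin N → ℝ)) =
      (ExteriorAlgebra.ιMulti ℝ p fun i => (Pi.single (J i) 1 : Fin N → ℝ)) *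
      (ExteriorAlgebra.ιMulti ℝ q fun i => (Pi.single (K i) 1 : Fin N → ℝ)) := by
    intro J K
    rw [ExteriorAlgebra.ιMulti_mul_ιMulti]
    congr 1
    funext i
    refine Fin.addCases (fun i => ?_) (fun i => ?_) i <;> simp
  simp only [hJK, smul_smul, smul_mul_assoc, mul_smul_comm, Finset.sum_mul_sum, Finset.smul_sum]
  refine Finset.sum_congr rfl fun J _ => Finset.sum_congr rfl fun K _ => ?_
  congr 1
  have : ((p + q).factorial : ℝ) ≠ 0 := by positivity
  have : (p.factorial : ℝ) ≠ 0 := by positivity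
  have : (q.factorial : ℝ) ≠ 0 := by positivity
  field_simp

lemma skew_wedgeF {N p q : ℕ} (ω : Form N p) (η : Form N q) (x : Pt N) :
    Skew (wedgeF p q ω η x) := by
  intro I τ
  simp only [wedgeF]
  rw [mul_left_comm]
  refine congrArg _ ?_
  rw [Finset.mul_sum]
  refine Fintype.sum_equiv (Equiv.mulLeft τ) _ _ fun ρ => ?_
  simp only [Equiv.coe_mulLeft, Equiv.Perm.sign_mul, Function.comp_apply, Equiv.Perm.coe_mul]
  push_cast
  linear_combination (-((Equiv.Perm.sign ρ : ℤ) : ℝ) *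
      (ω x fun i => I (τ (ρ (Fin.castAdd q i)))) * (η x fun j => I (τ (ρ (Fin.natAdd p j))))) *
      sign_mul_self τ

lemma skew_zero {N : ℕ} (f : (Fin 0 → Fin N) → ℝ) : Skew f := by
  intro I τ
  simp [Subsingleton.elim τ 1]

lemma Skew.const_mul {N p : ℕ} {f : (Fin p → Fin N) → ℝ} (hf : Skew f) (c : ℝ) :
    Skew fun I => c * f I := by
  intro I τ
  simp only [hf I τ]
  ring

lemma skew_wpow {N : ℕ} (ω : Form N 2) (m : ℕ) (x : Pt N) : Skew (wpow ω m x) := by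
  cases m with
  | zero => exact skew_zero _
  | succ m => exact skew_wedgeF _ _ _

lemma skew_wedgeList {N m : ℕ} (α : Fin m → Form N 1) (x : Pt N) :
    Skew (wedgeList m α x) := by
  cases m with
  | zero => exact skew_zero _
  | succ m => exact skew_wedgeF _ _ _

lemma skew_castF {N p q : ℕ} (h : p = q) (ω : Form N p) (x : Pt N) (hω : Skew (ω x)) :
    Skew (castF h ω x) := by
  subst h
  exact hω

lemma toExt_castF {N p q : ℕ} (h : p = q) (ω : Form N p) (x : Pt N) :
    toExt q (castF h ω x) = toExt p (ω x) := by
  subst h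
  rfl

lemma toExt_const_mul {N p : ℕ} (c : ℝ) (f : (Fin p → Fin N) → ℝ) :
    toExt p (fun I => c * f I) = c • toExt p f := by
  simp only [toExt, mul_smul, ← Finset.smul_sum]
  rw [smul_comm]

lemma toExt_add {N p : ℕ} (f g : (Fin p → Fin N) → ℝ) :
    toExt p (fun I => f I + g I) = toExt p f + toExt p g := by
  simp only [toExt, add_smul, Finset.sum_add_distrib, smul_add]

lemma toExt_wpow {N : ℕ} (ω : Form N 2) (m : ℕ) (x : Pt N) :
    toExt (2 * m) (wpow ω m x) = toExt 2 (ω x) ^ m := by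
  induction m with
  | zero =>
    rw [pow_zero]
    simp only [wpow]
    change toExt 0 (fun _ => 1) = 1
    simp [toExt]
  | succ m ih =>
    rw [pow_succ, ← ih]
    exact toExt_wedgeF _ _ _

lemma toExt_one {N : ℕ} (f : (Fin 1 → Fin N) → ℝ) :
    toExt 1 f = covec fun i => f fun _ => i := by
  have h : (fun i => f fun _ => i) = ∑ i, (f fun _ => i) • (Pi.single i 1 : Fin N → ℝ) := by
    simp [← Pi.single_smul, Finset.univ_sum_single]
  rw [h, toExt, ← (Equiv.funUnique (Fin 1) (Fin N)).symm.sum_comp]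
  simp only [map_sum, map_smul]
  simp [ExteriorAlgebra.ιMulti_apply]
  rfl

lemma toExt_wedgeList {N m : ℕ} (α : Fin m → Form N 1) (x : Pt N) :
    toExt m (wedgeList m α x) = ExteriorAlgebra.ιMulti ℝ m fun i => cov1 (α i) x := by
  induction m with
  | zero => simp [toExt, wedgeList]
  | succ m ih =>
    simp only [wedgeList]
    rw [toExt_wedgeF, ih, toExt_one]
    simp only [ExteriorAlgebra.ιMulti_apply]
    rw [List.ofFn_succ', List.concat_eq_append, List.prod_append, List.prod_singleton]
    rfl

/-- The quadratic element of the exterior algebra attached to a matrix. -/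
def quad {N : ℕ} (S : Matrix (Fin N) (Fin N) ℝ) : Ext N :=
  (2 : ℝ)⁻¹ • ∑ a, ∑ b, S a b • (covec (Pi.single a 1) * covec (Pi.single b 1))

lemma toExt_two {N : ℕ} (ω : Form N 2) (x : Pt N) : toExt 2 (ω x) = quad (mat2 ω x) := by
  rw [toExt, quad, ← (finTwoArrowEquiv (Fin N)).symm.sum_comp, Fintype.sum_prod_type]
  simp [ExteriorAlgebra.ιMulti_apply, mat2, Matrix.vecTail]

lemma toExt_mem {N p : ℕ} (f : (Fin p → Fin N) → ℝ) : toExt p f ∈ ⋀[ℝ]^p (Fin N → ℝ) := by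
  refine Submodule.smul_mem _ _ (Submodule.sum_mem _ fun I _ => Submodule.smul_mem _ _ ?_)
  exact ExteriorAlgebra.ιMulti_range ℝ p ⟨_, rfl⟩

lemma eq_zero_of_mem_exteriorPower {N p : ℕ} (h : N < p) {y : Ext N}
    (hy : y ∈ ⋀[ℝ]^p (Fin N → ℝ)) : y = 0 := by
  rw [← ExteriorAlgebra.ιMulti_span_fixedDegree] at hy
  have : Submodule.span ℝ (Set.range (ExteriorAlgebra.ιMulti ℝ p (M := Fin N → ℝ))) ≤ ⊥ := by
    rw [Submodule.span_le]
    rintro _ ⟨v, rfl⟩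
    refine AlternatingMap.map_linearDependent _ _ fun hv => ?_
    have := hv.fintype_card_le_finrank
    simp at this
    omega
  simpa using this hy

lemma mul_mem_exteriorPower {N p q : ℕ} {y z : Ext N} (hy : y ∈ ⋀[ℝ]^p (Fin N → ℝ))
    (hz : z ∈ ⋀[ℝ]^q (Fin N → ℝ)) : y * z ∈ ⋀[ℝ]^(p + q) (Fin N → ℝ) := by
  rw [ExteriorAlgebra.exteriorPower, pow_add]
  exact Submodule.mul_mem_mul hy hz

lemma covec_mem {N : ℕ} (v : Fin N → ℝ) : covec v ∈ ⋀[ℝ]^1 (Fin N → ℝ) := by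
  rw [ExteriorAlgebra.exteriorPower, pow_one]
  exact ⟨v, rfl⟩

lemma quad_mem {N : ℕ} (S : Matrix (Fin N) (Fin N) ℝ) : quad S ∈ ⋀[ℝ]^2 (Fin N → ℝ) :=
  Submodule.smul_mem _ _ (Submodule.sum_mem _ fun _ _ => Submodule.sum_mem _ fun _ _ =>
    Submodule.smul_mem _ _ (mul_mem_exteriorPower (covec_mem _) (covec_mem _)))

lemma quad_pow_mem {N : ℕ} (S : Matrix (Fin N) (Fin N) ℝ) (m : ℕ) :
    quad S ^ m ∈ ⋀[ℝ]^(2 * m) (Fin N → ℝ) := by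
  rw [ExteriorAlgebra.exteriorPower, pow_mul]
  exact Submodule.pow_mem_pow _ (quad_mem S) m

lemma quad_commute {N : ℕ} (S : Matrix (Fin N) (Fin N) ℝ) (y : Ext N) : Commute (quad S) y := by
  refine Commute.smul_left (Commute.sum_left _ _ _ fun a _ => Commute.sum_left _ _ _ fun b _ =>
    Commute.smul_left ?_ _) _
  induction y using ExteriorAlgebra.induction with
  | algebraMap r => exact (Algebra.commutes r _).symm
  | ι v =>
    change _ = _
    rw [mul_assoc, covec_mul_covec _ v, mul_neg, ← mul_assoc, covec_mul_covec _ v, neg_mul,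
      neg_neg, mul_assoc]
  | mul y z hy hz => exact hy.mul_right hz
  | add y z hy hz => exact hy.add_right hz

open Matrix in
lemma ctr_quad_mul {N : ℕ} {S : Matrix (Fin N) (Fin N) ℝ} (hS : Sᵀ = -S) (X : Fin N → ℝ)
    (y : Ext N) : ctr X (quad S * y) = covec (X ᵥ* S) * y + quad S * ctr X y := by
  have h1 : covec (X ᵥ* S) = (2 : ℝ)⁻¹ • ∑ a, ∑ b, S a b •
      (X a • covec (Pi.single b 1) - X b • covec (Pi.single a 1)) := by
    have hv : X ᵥ* S = ∑ a, ∑ b, (S a b * X a) • (Pi.single b 1 : Fin N → ℝ) := by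
      ext j
      simp [Matrix.vecMul, dotProduct, Finset.sum_apply, Pi.single_apply, mul_comm]
    have hv2 : X ᵥ* S = -∑ a, ∑ b, (S a b * X b) • (Pi.single a 1 : Fin N → ℝ) := by
      rw [hv, Finset.sum_comm, ← Finset.sum_neg_distrib]
      refine Finset.sum_congr rfl fun a _ => ?_
      rw [← Finset.sum_neg_distrib]
      refine Finset.sum_congr rfl fun b _ => ?_
      have := congrFun (congrFun hS a) b
      simp only [Matrix.transpose_apply, Matrix.neg_apply] at this
      rw [this, neg_mul, neg_smul]
    have h2 : X ᵥ* S = (2 : ℝ)⁻¹ • (∑ a, ∑ b, (S a b * X a) • (Pi.single b 1 : Fin N → ℝ) -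
        ∑ a, ∑ b, (S a b * X b) • (Pi.single a 1 : Fin N → ℝ)) := by
      rw [sub_eq_add_neg, ← hv, ← hv2]
      module
    rw [h2]
    simp only [map_smul, map_sub, map_sum, smul_sub, smul_smul, Finset.sum_sub_distrib]
  rw [h1, quad]
  simp only [smul_mul_assoc, Finset.sum_mul, map_smul, map_sum, mul_assoc, ctr_covec_mul,
    ← smul_add, ← Finset.sum_add_distrib, dotProduct_single, mul_one]
  congr 1
  refine Finset.sum_congr rfl fun a _ => Finset.sum_congr rfl fun b _ => ?_
  congr 1
  simp only [mul_sub, sub_mul, smul_mul_assoc, mul_smul_comm]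
  abel

/-- Contraction by the bivector with coefficient matrix `L`. -/
def lower {N : ℕ} (L : Matrix (Fin N) (Fin N) ℝ) (y : Ext N) : Ext N :=
  (2 : ℝ)⁻¹ • ∑ a, ∑ b, L a b • ctr (Pi.single a 1) (ctr (Pi.single b 1) y)

/-- The operator multiplying an element of the exterior algebra by its degree. -/
def euler {N : ℕ} (y : Ext N) : Ext N :=
  ∑ a, covec (Pi.single a 1) * ctr (Pi.single a 1) y

lemma toExt_sum {ι' : Type*} {N p : ℕ} (s : Finset ι') (f : ι' → (Fin p → Fin N) → ℝ) :
    toExt p (fun I => ∑ i ∈ s, f i I) = ∑ i ∈ s, toExt p (f i) := by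
  simp only [toExt, Finset.sum_smul, ← Finset.smul_sum]
  rw [Finset.sum_comm]

lemma lower_toExt {N p : ℕ} (L : Matrix (Fin N) (Fin N) ℝ) {F : (Fin (p + 2) → Fin N) → ℝ}
    (hF : Skew F) :
    lower L (toExt (p + 2) F) = toExt p fun J =>
      (2 : ℝ)⁻¹ * ∑ a, ∑ b, L a b * F (Fin.cons b (Fin.cons a J)) := by
  have h : ∀ a b, ctr (Pi.single a 1) (ctr (Pi.single b 1) (toExt (p + 2) F)) =
      toExt p fun J => F (Fin.cons b (Fin.cons a J)) := by
    intro a b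
    rw [ctr_toExt hF, ctr_toExt (hF.curry b)]
  rw [toExt_const_mul, lower]
  simp only [h, toExt_sum, toExt_const_mul]

lemma euler_toExt {N p : ℕ} {F : (Fin p → Fin N) → ℝ} (hF : Skew F) :
    euler (toExt p F) = (p : ℝ) • toExt p F := by
  cases p with
  | zero => simp [euler, toExt, ctr_one]
  | succ p =>
    rw [toExt_succ, euler]
    exact Finset.sum_congr rfl fun a _ => by rw [ctr_toExt hF]

lemma covec_row {N : ℕ} (S : Matrix (Fin N) (Fin N) ℝ) (a : Fin N) :
    covec (S a) = ∑ b, S a b • covec (Pi.single b 1) := by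
  have h : S a = ∑ b, S a b • (Pi.single b 1 : Fin N → ℝ) := by
    simp [← Pi.single_smul, Finset.univ_sum_single]
  conv_lhs => rw [h]
  simp only [map_sum, map_smul]

lemma two_smul_quad {N : ℕ} (S : Matrix (Fin N) (Fin N) ℝ) :
    (2 : ℝ) • quad S = ∑ a, covec (Pi.single a 1) * covec (S a) := by
  rw [quad, smul_smul, mul_inv_cancel₀ two_ne_zero, one_smul]
  simp only [covec_row, Finset.mul_sum, mul_smul_comm]

open Matrix in
lemma euler_quad_mul {N : ℕ} {W : Matrix (Fin N) (Fin N) ℝ} (hW : Wᵀ = -W) (y : Ext N) :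
    euler (quad W * y) = (2 : ℝ) • (quad W * y) + quad W * euler y := by
  simp only [euler, ctr_quad_mul hW, mul_add, Finset.sum_add_distrib, single_one_vecMul]
  congr 1
  · rw [← smul_mul_assoc, two_smul_quad, Finset.sum_mul]
    simp only [mul_assoc]
    rfl
  · rw [Finset.mul_sum]
    refine Finset.sum_congr rfl fun a _ => ?_
    rw [← mul_assoc, ← mul_assoc, (quad_commute W _).eq]

open Matrix in
lemma lower_quad_mul {N : ℕ} {W L : Matrix (Fin N) (Fin N) ℝ} (hW : Wᵀ = -W) (hL : Lᵀ = -L)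
    (hLW : L * W = -1) (y : Ext N) :
    lower L (quad W * y) = quad W * lower L y + euler y - ((N : ℝ) / 2) • y := by
  have h : ∀ a b, ctr (Pi.single a 1) (ctr (Pi.single b 1) (quad W * y)) =
      W b a • y - covec (W b) * ctr (Pi.single a 1) y + covec (W a) * ctr (Pi.single b 1) y +
        quad W * ctr (Pi.single a 1) (ctr (Pi.single b 1) y) := by
    intro a b
    rw [ctr_quad_mul hW, map_add, ctr_covec_mul, ctr_quad_mul hW, single_one_vecMul,
      single_one_vecMul, single_dotProduct, one_mul]
    simp only [Matrix.row]
    abel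
  have hrow : ∀ a, ∑ b, L a b • covec (W b) = -covec (Pi.single a 1) := by
    intro a
    have : ∑ b, L a b • W b = -(Pi.single a 1 : Fin N → ℝ) := by
      ext j
      have := congrFun (congrFun hLW a) j
      rw [Matrix.mul_apply] at this
      simpa [Finset.sum_apply, Matrix.one_apply, Pi.single_apply, eq_comm] using this
    rw [← map_neg, ← this, map_sum]
    simp only [map_smul]
  have hcol : ∀ b, ∑ a, L a b • covec (W a) = covec (Pi.single b 1) := by
    intro b
    rw [← neg_neg (covec (Pi.single b 1)), ← hrow, ← Finset.sum_neg_distrib]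
    refine Finset.sum_congr rfl fun a _ => ?_
    have := congrFun (congrFun hL b) a
    rw [Matrix.transpose_apply, Matrix.neg_apply] at this
    rw [this, neg_smul]
  have htr : ∑ a, ∑ b, L a b * W b a = -(N : ℝ) := by
    have := congrArg Matrix.trace hLW
    simpa [Matrix.trace, Matrix.mul_apply] using this
  simp only [lower, h, smul_add, smul_sub, Finset.sum_add_distrib, Finset.sum_sub_distrib]
  have e1 : ∑ a, ∑ b, L a b • W b a • y = -(N : ℝ) • y := by
    rw [← htr]
    simp only [Finset.sum_smul, mul_smul]
  have e2 : ∑ a, ∑ b, L a b • (covec (W b) * ctr (Pi.single a 1) y) = -euler y := by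
    simp only [← smul_mul_assoc, ← Finset.sum_mul, hrow, euler, neg_mul, Finset.sum_neg_distrib]
  have e3 : ∑ a, ∑ b, L a b • (covec (W a) * ctr (Pi.single b 1) y) = euler y := by
    rw [Finset.sum_comm]
    simp only [← smul_mul_assoc, ← Finset.sum_mul, hcol, euler]
  have e4 : ∑ a, ∑ b, L a b • (quad W * ctr (Pi.single a 1) (ctr (Pi.single b 1) y)) =
      quad W * ∑ a, ∑ b, L a b • ctr (Pi.single a 1) (ctr (Pi.single b 1) y) := by
    simp only [Finset.mul_sum, mul_smul_comm]
  rw [e1, e2, e3, e4, mul_smul_comm]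
  module

open Matrix in
lemma euler_quad_pow_mul {N : ℕ} {W : Matrix (Fin N) (Fin N) ℝ} (hW : Wᵀ = -W) {y : Ext N}
    {r : ℝ} (hy : euler y = r • y) (j : ℕ) :
    euler (quad W ^ j * y) = (r + 2 * j) • (quad W ^ j * y) := by
  induction j with
  | zero => simp [hy]
  | succ j ih =>
    rw [pow_succ', mul_assoc, euler_quad_mul hW, ih, mul_smul_comm]
    push_cast
    module

open Matrix in
lemma lower_quad_pow_mul {N : ℕ} {W L : Matrix (Fin N) (Fin N) ℝ} (hW : Wᵀ = -W)
    (hL : Lᵀ = -L) (hLW : L * W = -1) {y : Ext N} {r : ℝ} (hy : euler y = r • y) (j : ℕ) :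
    lower L (quad W ^ (j + 1) * y) = quad W ^ (j + 1) * lower L y +
      (((j : ℝ) + 1) * (r - N / 2 + j)) • (quad W ^ j * y) := by
  induction j with
  | zero =>
    simp only [zero_add, pow_one, pow_zero, one_mul]
    rw [lower_quad_mul hW hL hLW, hy]
    push_cast
    module
  | succ j ih =>
    rw [pow_succ', mul_assoc, lower_quad_mul hW hL hLW, ih, euler_quad_pow_mul hW hy, mul_add,
      ← mul_assoc, ← pow_succ', mul_smul_comm, ← mul_assoc, ← pow_succ']
    push_cast
    module

lemma Skew.append_two {N p : ℕ} {F : (Fin (p + 2) → Fin N) → ℝ} (hF : Skew F) (a b : Fin N)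
    (J : Fin p → Fin N) :
    F (Fin.append J ![a, b]) = -F (Fin.cons b (Fin.cons a J)) := by
  have e1 : Fin.append J ![a, b] = (Fin.snoc (Fin.snoc J a : Fin (p + 1) → Fin N) b) := by
    have : (![a, b] : Fin 2 → Fin N) = Fin.snoc (![a] : Fin 1 → Fin N) b := by
      ext i
      fin_cases i <;> rfl
    rw [this, Fin.append_snoc]
    congr 1
    exact Fin.append_right_eq_snoc _ _
  have e2 : (Fin.snoc (Fin.snoc J a : Fin (p + 1) → Fin N) b : Fin (p + 2) → Fin N) =
      (Fin.cons b (Fin.snoc J a : Fin (p + 1) → Fin N) : Fin (p + 2) → Fin N) ∘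
        finRotate (p + 2) := Fin.snoc_eq_cons_rotate _ _
  have e3 : (Fin.snoc J a : Fin (p + 1) → Fin N) =
      (Fin.cons a J : Fin (p + 1) → Fin N) ∘ finRotate (p + 1) := Fin.snoc_eq_cons_rotate _ _
  have e4 : F (Fin.cons b ((Fin.cons a J : Fin (p + 1) → Fin N) ∘ finRotate (p + 1))) =
      ((Equiv.Perm.sign (finRotate (p + 1)) : ℤ) : ℝ) * F (Fin.cons b (Fin.cons a J)) :=
    hF.curry b _ _
  rw [e1, e2, hF, e3, e4, sign_finRotate, sign_finRotate]
  have : ((-1 : ℝ) ^ p) * (-1) ^ p = 1 := by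
    rw [← mul_pow]
    simp
  simp only [Nat.add_sub_cancel, show p + 2 - 1 = p + 1 from rfl]
  push_cast
  rw [pow_succ]
  linear_combination (-F (Fin.cons b (Fin.cons a J))) * this

lemma pairF_wedgeF_two {N p : ℕ} (η : Form N (p + 2)) (P : Form N p) (Q : Form N 2) (x : Pt N)
    (hF : Skew (η x)) :
    pairF η (wedgeF p 2 P Q) x = pairF (fun _ J => -((2 : ℝ)⁻¹ *
      ∑ a, ∑ b, mat2 Q x a b * η x (Fin.cons b (Fin.cons a J)))) P x := by
  have h := sum_antisymm (η x) hF
    (fun I : Fin (p + 2) → Fin N => (P x fun i => I (Fin.castAdd 2 i)) *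
      (Q x fun j => I (Fin.natAdd p j)))
  simp only [Function.comp_apply, ← mul_assoc, smul_eq_mul] at h
  have h' : ∑ I, η x I * wedgeF p 2 P Q x I = ((p.factorial : ℝ) * (2 : ℕ).factorial)⁻¹ *
      (((p + 2).factorial : ℝ) * ∑ I : Fin (p + 2) → Fin N, (P x fun i => I (Fin.castAdd 2 i)) *
      (Q x fun j => I (Fin.natAdd p j)) * η x I) := by
    rw [← h, Finset.mul_sum]
    refine Finset.sum_congr rfl fun I _ => ?_
    rw [wedgeF]
    ring
  have hK : ∀ J : Fin p → Fin N, ∑ K : Fin 2 → Fin N, P x J * Q x K * η x (Fin.append J K) =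
      (∑ a, ∑ b, -(mat2 Q x a b * η x (Fin.cons b (Fin.cons a J)))) * P x J := by
    intro J
    rw [← (finTwoArrowEquiv (Fin N)).symm.sum_comp, Fintype.sum_prod_type, Finset.sum_mul]
    refine Finset.sum_congr rfl fun a _ => ?_
    rw [Finset.sum_mul]
    refine Finset.sum_congr rfl fun b _ => ?_
    rw [finTwoArrowEquiv_symm_apply, hF.append_two, mat2, Matrix.of_apply]
    ring
  rw [pairF, pairF, h', sum_append]
  simp only [Fin.append_left, Fin.append_right, hK]
  rw [Finset.mul_sum, Finset.mul_sum, Finset.mul_sum, Finset.mul_sum]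
  refine Finset.sum_congr rfl fun J _ => ?_
  simp only [Finset.sum_neg_distrib]
  have : ((p + 2).factorial : ℝ) ≠ 0 := by positivity
  have : (p.factorial : ℝ) ≠ 0 := by positivity
  rw [show ((2 : ℕ).factorial : ℝ) = 2 by norm_num [Nat.factorial]]
  field_simp

lemma lower_zero {N : ℕ} (L : Matrix (Fin N) (Fin N) ℝ) : lower L 0 = 0 := by
  simp [lower]

lemma Skew.lower {N p : ℕ} {F : (Fin (p + 2) → Fin N) → ℝ} (hF : Skew F)
    (L : Matrix (Fin N) (Fin N) ℝ) :
    Skew fun J : Fin p → Fin N =>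
      -((2 : ℝ)⁻¹ * ∑ a, ∑ b, L a b * F (Fin.cons b (Fin.cons a J))) := by
  intro I τ
  have h : ∀ a b, F (Fin.cons b (Fin.cons a (I ∘ τ))) =
      ((Equiv.Perm.sign τ : ℤ) : ℝ) * F (Fin.cons b (Fin.cons a I)) :=
    fun a b => (hF.curry b).curry a I τ
  simp only [h, mul_left_comm _ ((Equiv.Perm.sign τ : ℤ) : ℝ), ← Finset.mul_sum, mul_neg]

open Matrix in
/-- Wedging a form of degree `2m` with the complementary power of `ω₀` amounts to pairing it
with `Λ₀^m`. -/
lemma quad_pow_mul_toExt {n : ℕ} {ω₀ Λ₀ : Form (2 * n) 2} {x : Pt (2 * n)}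
    (hW : (mat2 ω₀ x)ᵀ = -mat2 ω₀ x) (hL : (mat2 Λ₀ x)ᵀ = -mat2 Λ₀ x)
    (hLW : mat2 Λ₀ x * mat2 ω₀ x = -1) {m : ℕ} (hm : m ≤ n) (η : Form (2 * n) (2 * m))
    (hη : Skew (η x)) :
    (n.factorial : ℝ) • (quad (mat2 ω₀ x) ^ (n - m) * toExt (2 * m) (η x)) =
      ((n - m).factorial * (m.factorial : ℝ)⁻¹ * pairF η (wpow Λ₀ m) x) •
        quad (mat2 ω₀ x) ^ n := by
  induction m with
  | zero =>
    have h0 : toExt (2 * 0) (η x) = (η x ![]) • (1 : Ext (2 * n)) := by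
      change toExt 0 (η x) = _
      simp [toExt, Subsingleton.elim default ![]]
    have h1 : pairF η (wpow Λ₀ 0) x = η x ![] := by
      change ((0 : ℕ).factorial : ℝ)⁻¹ * ∑ I : Fin 0 → Fin (2 * n), η x I * 1 = _
      simp [Subsingleton.elim default ![]]
    rw [h0, h1]
    simp [smul_smul]
  | succ m ih =>
    have hη' : Skew (p := 2 * m + 2) (η x) := hη
    obtain ⟨j, rfl⟩ : ∃ j, n = m + 1 + j := ⟨n - (m + 1), by omega⟩
    set W := mat2 ω₀ x
    set L := mat2 Λ₀ x
    set ζ : Form (2 * (m + 1 + j)) (2 * m) := fun _ J =>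
      -((2 : ℝ)⁻¹ * ∑ a, ∑ b, L a b * η x (Fin.cons b (Fin.cons a J))) with hζ
    have hi := ih (by omega) ζ (hη'.lower L)
    have hp : pairF η (wpow Λ₀ (m + 1)) x = pairF ζ (wpow Λ₀ m) x :=
      pairF_wedgeF_two (p := 2 * m) η (wpow Λ₀ m) Λ₀ x hη'
    have hlow : toExt (2 * m) (ζ x) = -lower L (toExt (2 * (m + 1)) (η x)) := by
      rw [hζ, toExt_neg]
      exact congrArg Neg.neg (lower_toExt (p := 2 * m) L hη').symm
    have hz : quad W ^ (j + 1) * toExt (2 * (m + 1)) (η x) = 0 :=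
      eq_zero_of_mem_exteriorPower (by omega)
        (mul_mem_exteriorPower (quad_pow_mem W (j + 1)) (toExt_mem _))
    have hl := lower_quad_pow_mul hW hL hLW (euler_toExt hη) j
    rw [hz, lower_zero] at hl
    rw [show m + 1 + j - m = j + 1 by omega, hlow, mul_neg,
      ← eq_neg_of_add_eq_zero_right hl.symm, ← hp] at hi
    rw [show m + 1 + j - (m + 1) = j by omega]
    have hc : ((j : ℝ) + 1) * (m + 1) ≠ 0 := by positivity
    apply smul_right_injective _ hc
    simp only
    rw [smul_comm]
    have hc' : ((j : ℝ) + 1) * ((2 * (m + 1) : ℕ) - ((2 * (m + 1 + j) : ℕ) : ℝ) / 2 + j) =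
        (j + 1) * (m + 1) := by
      push_cast
      ring
    rw [hc'] at hi
    rw [hi, smul_smul]
    congr 1
    rw [Nat.factorial_succ, Nat.factorial_succ]
    push_cast
    have : (m.factorial : ℝ) ≠ 0 := by positivity
    field_simp

open Matrix in
lemma quad_pow_ne_zero {n : ℕ} {ω₀ Λ₀ : Form (2 * n) 2} {x : Pt (2 * n)}
    (hW : (mat2 ω₀ x)ᵀ = -mat2 ω₀ x) (hL : (mat2 Λ₀ x)ᵀ = -mat2 Λ₀ x)
    (hLW : mat2 Λ₀ x * mat2 ω₀ x = -1) : quad (mat2 ω₀ x) ^ n ≠ 0 := by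
  intro h0
  let F : (Fin (2 * n) → Fin (2 * n)) → ℝ := fun I =>
    ((1 : Matrix (Fin (2 * n)) (Fin (2 * n)) ℝ).submatrix I id).det
  have hF : Skew F := by
    intro I τ
    exact Matrix.det_permute τ ((1 : Matrix (Fin (2 * n)) (Fin (2 * n)) ℝ).submatrix I id)
  have h := quad_pow_mul_toExt hW hL hLW le_rfl (fun _ => F) hF
  rw [h0, smul_zero, Nat.sub_self, pow_zero, one_mul] at h
  have hz : toExt (2 * n) F = 0 :=
    (smul_eq_zero.mp h).resolve_left (by positivity)
  have hs : Skew (fun _ : Fin (2 * n) → Fin (2 * n) => (0 : ℝ)) := by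
    intro I τ
    simp
  have := congrFun (toExt_injective hF hs (by rw [hz]; simp [toExt])) id
  simp [F] at this

open Matrix in
lemma ctr_ιMulti {N m : ℕ} (v : Fin m → Fin N → ℝ) {X : Fin N → ℝ} (hX : ∀ i, X ⬝ᵥ v i = 0) :
    ctr X (ExteriorAlgebra.ιMulti ℝ m v) = 0 := by
  induction m with
  | zero => simp [ctr_one]
  | succ m ih =>
    rw [ExteriorAlgebra.ιMulti_succ_apply, ctr_covec_mul, hX, zero_smul,
      ih (Matrix.vecTail v) fun i => hX i.succ, mul_zero, sub_zero]

lemma covec_mul_ιMulti {N m : ℕ} (v : Fin m → Fin N → ℝ) {u : Fin N → ℝ}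
    (hu : u ∈ Submodule.span ℝ (Set.range v)) :
    covec u * ExteriorAlgebra.ιMulti ℝ m v = 0 := by
  induction hu using Submodule.span_induction with
  | mem u hu =>
    obtain ⟨i, rfl⟩ := hu
    rw [ExteriorAlgebra.ιMulti_apply]
    exact ExteriorAlgebra.ι_mul_prod_list v i
  | zero => simp
  | add u w _ _ hu hw => rw [covec, map_add, add_mul, hu, hw, add_zero]
  | smul c u _ hu => rw [covec, map_smul, smul_mul_assoc, hu, smul_zero]

open Matrix in
lemma ctr_quad_pow_mul {N : ℕ} {W : Matrix (Fin N) (Fin N) ℝ} (hW : Wᵀ = -W) (X : Fin N → ℝ)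
    (y : Ext N) (j : ℕ) :
    ctr X (quad W ^ (j + 1) * y) =
      ((j : ℝ) + 1) • (covec (X ᵥ* W) * (quad W ^ j * y)) + quad W ^ (j + 1) * ctr X y := by
  induction j with
  | zero => simp [ctr_quad_mul hW]
  | succ j ih =>
    rw [pow_succ', mul_assoc, ctr_quad_mul hW, ih, mul_add, mul_smul_comm, ← mul_assoc (quad W),
      (quad_commute W (covec _)).eq, mul_assoc (covec _), ← mul_assoc (quad W), ← pow_succ',
      ← mul_assoc (quad W), ← pow_succ']
    push_cast
    module

open Matrix in
/-- Wedging with the symplectic dual of `X` is, up to a factor, contraction with `X`. -/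
lemma covec_mul_covec_mul_quad_pow {N r j : ℕ} {W : Matrix (Fin N) (Fin N) ℝ} (hW : Wᵀ = -W)
    {A : Ext N} (hA : A ∈ ⋀[ℝ]^r (Fin N → ℝ)) (hr : 2 * (j + 1) + r = N) {X : Fin N → ℝ}
    (hX : ctr X A = 0) (γ : Fin N → ℝ) :
    ((j : ℝ) + 1) • (covec γ * (covec (X ᵥ* W) * (quad W ^ j * A))) =
      (X ⬝ᵥ γ) • (quad W ^ (j + 1) * A) := by
  have h0 : covec γ * (quad W ^ (j + 1) * A) = 0 :=
    eq_zero_of_mem_exteriorPower (by omega)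
      (mul_mem_exteriorPower (covec_mem γ) (mul_mem_exteriorPower (quad_pow_mem W (j + 1)) hA))
  have h := ctr_covec_mul X γ (quad W ^ (j + 1) * A)
  rw [h0, map_zero, ctr_quad_pow_mul hW, hX, mul_zero, add_zero, mul_smul_comm] at h
  exact (sub_eq_zero.mp h.symm).symm

/-- An element `A` of degree `r` of the exterior algebra whose annihilator contains `D`,
where `D` is nondegenerate for `L` and contained in the kernel of `S` transported by `L`. -/
structure Adapted {N : ℕ} (W L S : Matrix (Fin N) (Fin N) ℝ) (r : ℕ)
    (D : Submodule ℝ (Fin N → ℝ)) (A : Ext N) : Prop where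
  skew_W : W.transpose = -W
  skew_S : S.transpose = -S
  inv : L * W = -1
  mem : A ∈ ⋀[ℝ]^r (Fin N → ℝ)
  covec_mul : ∀ u ∈ D, covec u * A = 0
  ctr_eq : ∀ X : Fin N → ℝ, (∀ u ∈ D, X ⬝ᵥ u = 0) → ctr X A = 0
  proj : ∀ β : Fin N → ℝ, ∃ u ∈ D, ∀ v ∈ D, Matrix.vecMul (β - u) L ⬝ᵥ v = 0
  ker : ∀ u ∈ D, Matrix.vecMul (Matrix.vecMul u L) S = 0

namespace Adapted

variable {N r j : ℕ} {W L S : Matrix (Fin N) (Fin N) ℝ} {D : Submodule ℝ (Fin N → ℝ)} {A : Ext N}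

open Matrix

lemma covec_mul_quad_pow (h : Adapted W L S r D A) {u : Fin N → ℝ} (hu : u ∈ D) (j : ℕ) :
    covec u * (quad W ^ j * A) = 0 := by
  rw [← mul_assoc, ← ((quad_commute W (covec u)).pow_left j).eq, mul_assoc, h.covec_mul u hu,
    mul_zero]

/-- Every covector is, modulo `D`, the symplectic dual of a vector annihilating `A`. -/
lemma exists_dual (h : Adapted W L S r D A) (β : Fin N → ℝ) :
    ∃ X, ctr X A = 0 ∧ β - X ᵥ* W ∈ D ∧ ∀ γ : Fin N → ℝ,
      (X ᵥ* S) ⬝ᵥ γ = -(((β ᵥ* L) ᵥ* S) ⬝ᵥ γ) := by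
  obtain ⟨u, hu, hp⟩ := h.proj β
  have hb : (-((β - u) ᵥ* L)) ᵥ* W = β - u := by
    rw [neg_vecMul, vecMul_vecMul, h.inv, vecMul_neg, vecMul_one, neg_neg]
  refine ⟨-((β - u) ᵥ* L), h.ctr_eq _ fun v hv => by rw [neg_dotProduct, hp v hv, neg_zero], ?_,
    fun γ => ?_⟩
  · rw [hb, sub_sub_cancel]
    exact hu
  · rw [neg_vecMul, sub_vecMul, sub_vecMul, h.ker u hu, sub_zero, neg_dotProduct]

lemma dotProduct_vecMul_skew {B : Matrix (Fin N) (Fin N) ℝ} (hB : Bᵀ = -B) (X Y : Fin N → ℝ) :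
    X ⬝ᵥ (Y ᵥ* B) = -((X ᵥ* B) ⬝ᵥ Y) := by
  rw [dotProduct_comm, ← dotProduct_mulVec, ← vecMul_transpose, hB, vecMul_neg,
    dotProduct_neg, dotProduct_comm]

lemma quad_mul_quad_pow (h : Adapted W L S r D A) (hr : 2 * (j + 1) + r = N) :
    ((j : ℝ) + 1) • (quad S * (quad W ^ j * A)) =
      ((2 : ℝ)⁻¹ * ∑ a, ∑ b, S a b * L a b) • (quad W ^ (j + 1) * A) := by
  have key : ∀ a, ((j : ℝ) + 1) • (covec (Pi.single a 1) * covec (S a) * (quad W ^ j * A)) =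
      (∑ b, S a b * L a b) • (quad W ^ (j + 1) * A) := by
    intro a
    obtain ⟨X, hX, hD, hS⟩ := h.exists_dual (Pi.single a 1)
    have h1 := covec_mul_covec_mul_quad_pow h.skew_W h.mem hr hX (S a)
    have h2 : covec (Pi.single a 1) * (quad W ^ j * A) =
        covec (X ᵥ* W) * (quad W ^ j * A) := by
      rw [← sub_eq_zero, ← sub_mul, ← map_sub]
      exact h.covec_mul_quad_pow hD j
    have h3 : X ⬝ᵥ S a = -∑ b, S a b * L a b := by
      have e1 : S a = Pi.single a 1 ᵥ* S := (single_one_vecMul _ _).symm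
      have e2 := hS (Pi.single a 1)
      have e3 := dotProduct_vecMul_skew h.skew_S (Pi.single a 1 ᵥ* L) (Pi.single a 1)
      rw [e1, dotProduct_vecMul_skew h.skew_S, e2, ← e3, ← e1, single_one_vecMul]
      simp [dotProduct, mul_comm, Matrix.row]
    rw [covec_mul_covec, neg_mul, mul_assoc, h2, smul_neg, h1, h3, neg_smul, neg_neg]
  have h2 : (2 : ℝ) • (((j : ℝ) + 1) • (quad S * (quad W ^ j * A))) =
      (∑ a, ∑ b, S a b * L a b) • (quad W ^ (j + 1) * A) := by
    rw [smul_comm, ← smul_mul_assoc, two_smul_quad, Finset.sum_mul, Finset.smul_sum,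
      Finset.sum_smul]
    exact Finset.sum_congr rfl fun a _ => key a
  rw [mul_smul, ← h2, smul_smul, inv_mul_cancel₀ two_ne_zero, one_smul]

lemma covec_mul_covec_mul_core (h : Adapted W L S r D A) (hr : 2 * (j + 2) + r = N)
    (β γ : Fin N → ℝ) {c : ℝ}
    (hc : ((j : ℝ) + 1) * c = -((2 : ℝ)⁻¹ * ∑ a, ∑ b, S a b * L a b)) :
    (((j : ℝ) + 1) * (j + 2)) • (covec β * covec γ * ((quad S + c • quad W) * quad W ^ j * A)) =
      -((((β ᵥ* L) ᵥ* S) ⬝ᵥ (γ ᵥ* L)) • (quad W ^ (j + 2) * A)) := by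
  obtain ⟨X, hX, hXD, hXS⟩ := h.exists_dual β
  obtain ⟨Y, hY, hYD, hYS⟩ := h.exists_dual γ
  set b := X ᵥ* W with hb
  set e := Y ᵥ* W with he
  have hred : covec β * covec γ * ((quad S + c • quad W) * quad W ^ j * A) =
      (quad S + c • quad W) * (covec b * (covec e * (quad W ^ j * A))) := by
    have hcomm : ∀ y, Commute (quad S + c • quad W) y := fun y =>
      (quad_commute S y).add_left ((quad_commute W y).smul_left c)
    have hz : ∀ {u v}, u - v ∈ D → covec u * (quad W ^ j * A) = covec v * (quad W ^ j * A) := by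
      intro u v huv
      rw [← sub_eq_zero, ← sub_mul, ← map_sub]
      exact h.covec_mul_quad_pow huv j
    rw [mul_assoc _ _ A, ← mul_assoc, ← (hcomm (covec β * covec γ)).eq, mul_assoc, mul_assoc,
      hz hYD, ← mul_assoc (covec β), covec_mul_covec, neg_mul, mul_assoc, hz hXD,
      ← mul_assoc, ← neg_mul, ← covec_mul_covec, mul_assoc]
  have p1 := covec_mul_covec_mul_quad_pow (j := j + 1) h.skew_W h.mem hr hY (X ᵥ* S)
  have p2 := covec_mul_covec_mul_quad_pow (j := j + 1) h.skew_W h.mem hr hY b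
  have p3 := h.quad_mul_quad_pow (j := j + 1) hr
  have h0 : quad S * (covec e * (quad W ^ (j + 1) * A)) = 0 :=
    eq_zero_of_mem_exteriorPower (by omega) (mul_mem_exteriorPower (quad_mem S)
      (mul_mem_exteriorPower (covec_mem e)
        (mul_mem_exteriorPower (quad_pow_mem W (j + 1)) h.mem)))
  have p4 := ctr_quad_mul h.skew_S X (covec e * (quad W ^ (j + 1) * A))
  rw [h0, map_zero, ctr_covec_mul, ctr_quad_pow_mul h.skew_W, hX, mul_zero, add_zero,
    mul_smul_comm, ← mul_assoc (covec e) (covec _), covec_mul_covec e, neg_mul,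
    mul_assoc (covec _) (covec e), smul_neg, sub_neg_eq_add, mul_add, mul_smul_comm, mul_smul_comm] at p4
  rw [← he] at p1 p2
  rw [← hb] at p4
  have d1 : Y ⬝ᵥ b = -(X ⬝ᵥ e) := by
    rw [hb, dotProduct_vecMul_skew h.skew_W, dotProduct_comm]
  have d2 : Y ⬝ᵥ (X ᵥ* S) = ((β ᵥ* L) ᵥ* S) ⬝ᵥ (γ ᵥ* L) := by
    rw [dotProduct_comm, hXS, ← dotProduct_comm, dotProduct_vecMul_skew h.skew_S, hYS,
      dotProduct_comm ((β ᵥ* L) ᵥ* S), dotProduct_vecMul_skew h.skew_S]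
    ring
  have hq : quad W * (covec b * (covec e * (quad W ^ j * A))) =
      covec b * (covec e * (quad W ^ (j + 1) * A)) := by
    rw [← mul_assoc, (quad_commute W (covec b)).eq, mul_assoc, ← mul_assoc _ (covec e),
      (quad_commute W (covec e)).eq, mul_assoc, ← mul_assoc (quad W), ← pow_succ']
  rw [hred, add_mul (quad S), smul_mul_assoc, hq, ← d2]
  rw [d1] at p2
  push_cast at p1 p2 p3 p4
  rw [show j + 1 + 1 = j + 2 from rfl] at p1 p2 p3
  generalize quad S * (covec b * (covec e * (quad W ^ j * A))) = y1 at *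
  generalize covec b * (covec e * (quad W ^ (j + 1) * A)) = y2 at *
  generalize covec (X ᵥ* S) * (covec e * (quad W ^ (j + 1) * A)) = y3 at *
  generalize quad S * (quad W ^ (j + 1) * A) = y4 at *
  have hg : (2 : ℝ)⁻¹ * ∑ a, ∑ b, S a b * L a b = -(((j : ℝ) + 1) * c) := by linarith
  rw [hg] at p3
  linear_combination (norm := module) (-((j : ℝ) + 2)) • p4 - p1 - (X ⬝ᵥ e) • p3 + (((j : ℝ) + 1) * c) • p2

end Adapted

lemma AltArr.skew {N p : ℕ} {f : (Fin p → Fin N) → ℝ} (hf : AltArr f) : Skew f := hf.1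

lemma Skew.transpose_mat2 {N : ℕ} {ω : Form N 2} {x : Pt N} (hω : Skew (ω x)) :
    (mat2 ω x).transpose = -mat2 ω x := by
  ext i j
  have h := hω.swap j i ![]
  exact h

lemma linearIndependent_of_fAlpha_ne_zero {n k : ℕ} {Λ₀ : Form (2 * n) 2}
    {α : Fin (2 * (n - k)) → Form (2 * n) 1} {x : Pt (2 * n)} (hf : fAlpha Λ₀ α x ≠ 0) :
    LinearIndependent ℝ fun i => cov1 (α i) x := by
  by_contra hd
  have h0 : wedgeList (2 * (n - k)) α x = fun _ => 0 := by
    refine toExt_injective (skew_wedgeList α x) (fun I τ => by simp) ?_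
    rw [toExt_wedgeList, AlternatingMap.map_linearDependent _ _ hd]
    simp [toExt]
  exact hf (by simp [fAlpha, pairF, h0])

section Pointwise

variable {n k : ℕ} {ω₀ Λ₀ σ : Form (2 * n) 2} {α : Fin (2 * (n - k)) → Form (2 * n) 1}
  {x : Pt (2 * n)}

open Matrix

lemma quad_pow_mul_ιMulti (hkn : k ≤ n) (hW : (mat2 ω₀ x)ᵀ = -mat2 ω₀ x)
    (hL : (mat2 Λ₀ x)ᵀ = -mat2 Λ₀ x) (hLW : mat2 Λ₀ x * mat2 ω₀ x = -1) :
    (n.factorial : ℝ) • (quad (mat2 ω₀ x) ^ k *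
        ExteriorAlgebra.ιMulti ℝ (2 * (n - k)) fun i => cov1 (α i) x) =
      (k.factorial * fAlpha Λ₀ α x) • quad (mat2 ω₀ x) ^ n := by
  have h := quad_pow_mul_toExt hW hL hLW (Nat.sub_le n k) _ (skew_wedgeList α x)
  rw [toExt_wedgeList, Nat.sub_sub_self hkn] at h
  rw [h]
  congr 1
  simp only [fAlpha, pairF, smulF, mul_left_comm _ ((n - k).factorial : ℝ)⁻¹, ← Finset.mul_sum]
  ring

lemma adapted_of_fAlpha_ne_zero (hk : 1 ≤ k) (hkn : k ≤ n) (hW : (mat2 ω₀ x)ᵀ = -mat2 ω₀ x)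
    (hL : (mat2 Λ₀ x)ᵀ = -mat2 Λ₀ x) (hS : (mat2 σ x)ᵀ = -mat2 σ x)
    (hLW : mat2 Λ₀ x * mat2 ω₀ x = -1) (hf : fAlpha Λ₀ α x ≠ 0)
    (hker : ∀ i, (cov1 (α i) x ᵥ* mat2 Λ₀ x) ᵥ* mat2 σ x = 0) :
    Adapted (mat2 ω₀ x) (mat2 Λ₀ x) (mat2 σ x) (2 * (n - k))
      (Submodule.span ℝ (Set.range fun i => cov1 (α i) x))
      (ExteriorAlgebra.ιMulti ℝ (2 * (n - k)) fun i => cov1 (α i) x) := by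
  set v := fun i => cov1 (α i) x with hv
  set W := mat2 ω₀ x
  set L := mat2 Λ₀ x
  have hA : ExteriorAlgebra.ιMulti ℝ (2 * (n - k)) v ∈ ⋀[ℝ]^(2 * (n - k)) (Fin (2 * n) → ℝ) :=
    ExteriorAlgebra.ιMulti_range ℝ _ ⟨_, rfl⟩
  have hne : quad W ^ k * ExteriorAlgebra.ιMulti ℝ (2 * (n - k)) v ≠ 0 := by
    intro h0
    have h := quad_pow_mul_ιMulti (α := α) hkn hW hL hLW
    rw [h0, smul_zero] at h
    exact smul_ne_zero (mul_ne_zero (by positivity) hf) (quad_pow_ne_zero hW hL hLW) h.symm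
  have hnondeg : ∀ u ∈ Submodule.span ℝ (Set.range v), (∀ i, (u ᵥ* L) ⬝ᵥ v i = 0) → u = 0 := by
    intro u hu hui
    obtain ⟨j, rfl⟩ : ∃ j, k = j + 1 := ⟨k - 1, by omega⟩
    have hXW : (-(u ᵥ* L)) ᵥ* W = u := by
      rw [neg_vecMul, vecMul_vecMul, hLW, vecMul_neg, vecMul_one, neg_neg]
    have h := covec_mul_covec_mul_quad_pow (j := j) hW hA (by omega)
      (ctr_ιMulti v (X := -(u ᵥ* L)) fun i => by rw [neg_dotProduct, hui, neg_zero]) (-(u ᵥ* L))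
    rw [hXW, ← mul_assoc (covec u), ← ((quad_commute W (covec u)).pow_left j).eq, mul_assoc,
      covec_mul_ιMulti v hu, mul_zero, mul_zero, smul_zero] at h
    have hX := (smul_eq_zero.mp h.symm).resolve_right hne
    rw [dotProduct_self_eq_zero] at hX
    rw [← hXW, hX, zero_vecMul]
  set V : Matrix (Fin (2 * (n - k))) (Fin (2 * n)) ℝ := Matrix.of v with hV
  have hspan : ∀ c, c ᵥ* V ∈ Submodule.span ℝ (Set.range v) := by
    intro c
    rw [vecMul_eq_sum]
    exact Submodule.sum_mem _ fun i _ => Submodule.smul_mem _ _ (Submodule.subset_span ⟨i, rfl⟩)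
  have hG : ∀ c i, (c ᵥ* (V * L * Vᵀ)) i = ((c ᵥ* V) ᵥ* L) ⬝ᵥ v i := by
    intro c i
    rw [← vecMul_vecMul, ← vecMul_vecMul]
    rfl
  have hsurj : Function.Surjective fun c => c ᵥ* (V * L * Vᵀ) := by
    rw [vecMul_surjective_iff_isUnit, ← vecMul_injective_iff_isUnit]
    refine (injective_iff_map_eq_zero (vecMulLinear (V * L * Vᵀ))).mpr fun c hc => ?_
    have h0 := hnondeg _ (hspan c) fun i => by rw [← hG]; exact congrFun hc i
    have hli := linearIndependent_of_fAlpha_ne_zero hf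
    have hinj : Function.Injective V.vecMul := vecMul_injective_iff.mpr hli
    exact hinj (h0.trans (zero_vecMul V).symm)
  refine ⟨hW, hS, hLW, hA, fun u hu => covec_mul_ιMulti v hu,
    fun X hX => ctr_ιMulti v fun i => hX _ (Submodule.subset_span ⟨i, rfl⟩), fun β => ?_, ?_⟩
  · obtain ⟨c, hc⟩ := hsurj fun i => (β ᵥ* L) ⬝ᵥ v i
    refine ⟨c ᵥ* V, hspan c, fun w hw => ?_⟩
    induction hw using Submodule.span_induction with
    | mem w hw =>
      obtain ⟨i, rfl⟩ := hw
      rw [sub_vecMul, sub_dotProduct, ← hG, sub_eq_zero]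
      exact (congrFun hc i).symm
    | zero => exact dotProduct_zero _
    | add w z _ _ hw hz => rw [dotProduct_add, hw, hz, add_zero]
    | smul c w _ hw => rw [dotProduct_smul, hw, smul_zero]
  · intro u hu
    induction hu using Submodule.span_induction with
    | mem w hw =>
      obtain ⟨i, rfl⟩ := hw
      exact hker i
    | zero => simp
    | add w z _ _ hw hz => rw [add_vecMul, add_vecMul, hw, hz, add_zero]
    | smul c w _ hw => rw [smul_vecMul, smul_vecMul, hw, smul_zero]

lemma mat2_sharpF {N : ℕ} (Λ σ : Form N 2) (x : Pt N) :
    mat2 (sharpF Λ 2 σ) x = (mat2 Λ x)ᵀ * mat2 σ x * mat2 Λ x := by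
  ext a b
  simp only [mat2, of_apply, sharpF, mul_apply, transpose_apply, Finset.sum_mul]
  rw [← (finTwoArrowEquiv (Fin N)).symm.sum_comp, Fintype.sum_prod_type, Finset.sum_comm]
  simp only [finTwoArrowEquiv_symm_apply, Fin.prod_univ_two]
  norm_num
  exact Finset.sum_congr rfl fun c _ => Finset.sum_congr rfl fun d _ => by ring

lemma braF_eq {N : ℕ} (Λ : Form N 2) (g h : Pt N → ℝ) (x : Pt N) :
    braF Λ g h x = (grad g x ᵥ* mat2 Λ x) ⬝ᵥ grad h x := by
  simp only [braF, mat2, grad, dotProduct, vecMul, of_apply, Finset.sum_mul]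
  rw [Finset.sum_comm]
  exact Finset.sum_congr rfl fun c _ => Finset.sum_congr rfl fun d _ => by ring

lemma vecMul_mat2_eq_zero_iff {N : ℕ} (Λ : Form N 2) (x : Pt N) (β : Fin N → ℝ) :
    (∀ b, ∑ a, Λ x ![a, b] * β a = 0) ↔ β ᵥ* mat2 Λ x = 0 := by
  simp only [funext_iff, vecMul, dotProduct, mat2, of_apply, mul_comm, Pi.zero_apply]

lemma sharpV_eq {N : ℕ} (Λ : Form N 2) (x : Pt N) (β : Fin N → ℝ) :
    sharpV Λ β x = β ᵥ* mat2 Λ x := by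
  ext j
  simp only [sharpV, vecMul, dotProduct, mat2, of_apply, mul_comm]

lemma toExt_coreFormA : toExt (2 + 2 * (k - 2) + 2 * (n - k)) (coreFormA k ω₀ Λ₀ σ α x) =
    ((k - 2).factorial : ℝ)⁻¹ • ((quad (mat2 σ x) +
      (gEven Λ₀ σ x / ((k : ℝ) - 1)) • quad (mat2 ω₀ x)) * quad (mat2 ω₀ x) ^ (k - 2) *
        ExteriorAlgebra.ιMulti ℝ (2 * (n - k)) fun i => cov1 (α i) x) := by
  rw [coreFormA, toExt_wedgeF, toExt_wedgeF, toExt_wedgeList]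
  unfold addF fsmulF smulF
  rw [toExt_add, toExt_const_mul, toExt_const_mul, toExt_wpow, toExt_two, toExt_two,
    mul_smul_comm, smul_mul_assoc]

lemma gEven_eq : gEven Λ₀ σ x =
    -((2 : ℝ)⁻¹ * ∑ a, ∑ b, mat2 σ x a b * mat2 Λ₀ x a b) := by
  rw [gEven, pairF, ← (finTwoArrowEquiv (Fin (2 * n))).symm.sum_comp, Fintype.sum_prod_type]
  simp [mat2]

lemma bracket_formula (hk : 2 ≤ k) (hkn : k ≤ n) (hL : (mat2 Λ₀ x)ᵀ = -mat2 Λ₀ x)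
    (h : Adapted (mat2 ω₀ x) (mat2 Λ₀ x) (mat2 σ x) (2 * (n - k))
      (Submodule.span ℝ (Set.range fun i => cov1 (α i) x))
      (ExteriorAlgebra.ιMulti ℝ (2 * (n - k)) fun i => cov1 (α i) x))
    (hf : fAlpha Λ₀ α x ≠ 0) (h₁ h₂ : Pt (2 * n) → ℝ)
    (hdeg : 1 + 1 + (2 + 2 * (k - 2) + 2 * (n - k)) = 2 * n) (I : Fin (2 * n) → Fin (2 * n)) :
    braF (sharpF Λ₀ 2 σ) h₁ h₂ x * volF n ω₀ x I = -(fAlpha Λ₀ α x)⁻¹ *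
      castF hdeg (wedgeF (1 + 1) (2 + 2 * (k - 2) + 2 * (n - k))
        (wedgeF 1 1 (dF h₁) (dF h₂)) (coreFormA k ω₀ Λ₀ σ α)) x I := by
  have hbra : braF (sharpF Λ₀ 2 σ) h₁ h₂ x = ((grad h₁ x ᵥ* mat2 Λ₀ x) ᵥ* mat2 σ x) ⬝ᵥ
      (grad h₂ x ᵥ* mat2 Λ₀ x) := by
    rw [braF_eq, mat2_sharpF, hL, ← vecMul_vecMul, ← vecMul_vecMul, vecMul_neg, neg_vecMul,
      neg_vecMul, neg_dotProduct, Adapted.dotProduct_vecMul_skew hL]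
  have hvol : quad (mat2 ω₀ x) ^ k * (ExteriorAlgebra.ιMulti ℝ (2 * (n - k)) fun i =>
      cov1 (α i) x) = ((n.factorial : ℝ)⁻¹ * (k.factorial * fAlpha Λ₀ α x)) •
        quad (mat2 ω₀ x) ^ n := by
    rw [mul_smul, ← quad_pow_mul_ιMulti hkn h.skew_W hL h.inv, smul_smul, inv_mul_cancel₀,
      one_smul]
    positivity
  refine congrFun (toExt_injective (((skew_wpow ω₀ n x).const_mul _).const_mul _)
    ((skew_castF hdeg _ x (skew_wedgeF _ _ x)).const_mul _) ?_) I
  rw [toExt_const_mul, toExt_const_mul, toExt_const_mul, toExt_castF, toExt_wedgeF, toExt_wedgeF,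
    toExt_coreFormA, toExt_wpow, toExt_two, toExt_one, toExt_one, hbra]
  obtain ⟨j, rfl⟩ : ∃ j, k = j + 2 := ⟨k - 2, by omega⟩
  have hc : ((j : ℝ) + 1) * (gEven Λ₀ σ x / (((j + 2 : ℕ) : ℝ) - 1)) =
      -((2 : ℝ)⁻¹ * ∑ a, ∑ b, mat2 σ x a b * mat2 Λ₀ x a b) := by
    rw [← gEven_eq]
    push_cast
    have : (j : ℝ) + 1 ≠ 0 := by positivity
    rw [show (j : ℝ) + 2 - 1 = j + 1 by ring]
    field_simp
  have hcore := h.covec_mul_covec_mul_core (by omega) (grad h₁ x) (grad h₂ x) hc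
  rw [hvol] at hcore
  have hj : ((j : ℝ) + 1) * (j + 2) ≠ 0 := by positivity
  change _ = -(fAlpha Λ₀ α x)⁻¹ • (covec (grad h₁ x) * covec (grad h₂ x) * _)
  rw [Nat.add_sub_cancel, mul_smul_comm]
  apply smul_right_injective _ hj
  simp only
  rw [smul_comm _ (-(fAlpha Λ₀ α x)⁻¹), smul_comm _ ((j.factorial : ℝ)⁻¹), hcore]
  simp only [smul_smul, ← neg_smul]
  congr 1
  rw [Nat.factorial_succ, Nat.factorial_succ]
  push_cast
  have : (j.factorial : ℝ) ≠ 0 := by positivity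
  field_simp
  ring

lemma isUnit_det_of_mul_eq_neg_one {N : ℕ} {L W : Matrix (Fin N) (Fin N) ℝ} (hLW : L * W = -1) :
    IsUnit L.det := by
  rw [← isUnit_iff_isUnit_det]
  exact IsUnit.of_mul_eq_one (-W) (by rw [mul_neg, hLW, neg_neg])

lemma rank_mat2_sharpF (hL : IsUnit (mat2 Λ₀ x).det) :
    (mat2 (sharpF Λ₀ 2 σ) x).rank = (mat2 σ x).rank := by
  rw [mat2_sharpF, rank_mul_eq_left_of_isUnit_det _ _ hL,
    rank_mul_eq_right_of_isUnit_det _ _ (by rwa [det_transpose])]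

lemma rank_le_of_mem_closure {N r : ℕ} {M U : Set (Pt N)} (hMo : IsOpen M) (hUd : M ⊆ closure U)
    {τ : Form N 2} (hτ : ∀ I, ContinuousOn (fun x => τ x I) M)
    (hr : ∀ x ∈ U, (mat2 τ x).rank ≤ r) {x : Pt N} (hx : x ∈ M) : (mat2 τ x).rank ≤ r := by
  obtain ⟨κ, a, ha, hspan, hli⟩ := exists_linearIndependent' ℝ (mat2 τ x).row
  have : Fintype κ := Fintype.ofInjective a ha
  have hcard : (mat2 τ x).rank = Fintype.card κ := by
    rw [rank_eq_finrank_span_row, ← hspan, finrank_span_eq_card hli]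
  have hcont : ContinuousAt (fun y => (mat2 τ y).row ∘ a) x := by
    refine continuousAt_pi.mpr fun i => continuousAt_pi.mpr fun b => ?_
    exact (hτ ![a i, b]).continuousAt (hMo.mem_nhds hx)
  have hev := hcont.eventually (isOpen_setOfPred_linearIndependent.mem_nhds hli)
  obtain ⟨y, hy, hyU⟩ := mem_closure_iff_nhds.mp (hUd hx) _ hev
  refine le_trans ?_ (hr y hyU)
  rw [hcard, rank_eq_finrank_span_row]
  have hy' : LinearIndependent ℝ ((mat2 τ y).row ∘ a) := hy
  rw [← finrank_span_eq_card hy']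
  exact Submodule.finrank_mono (Submodule.span_mono (Set.range_comp_subset_range _ _))

lemma ker_eq_span {N m : ℕ} {B : Matrix (Fin N) (Fin N) ℝ} {v : Fin m → Fin N → ℝ}
    (hv : LinearIndependent ℝ v) (hB : ∀ i, v i ᵥ* B = 0) (hr : B.rank + m = N) :
    B.vecMulLinear.ker = Submodule.span ℝ (Set.range v) := by
  symm
  apply Submodule.eq_of_le_of_finrank_eq
  · rw [Submodule.span_le]
    rintro _ ⟨i, rfl⟩
    exact hB i
  · have h := B.vecMulLinear.finrank_range_add_finrank_ker
    have hrank : Module.finrank ℝ B.vecMulLinear.range = B.rank := by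
      rw [← rank_transpose, rank, ← vecMulLinear_transpose, transpose_transpose]
    rw [hrank, Module.finrank_fin_fun] at h
    rw [finrank_span_eq_card hv, Fintype.card_fin]
    omega

end Pointwise

theorem almost_poisson_with_prescribed_kernel
    (n k : ℕ) (hk : 2 ≤ k) (hkn : k ≤ n)
    (M : Set (Pt (2 * n))) (hMo : IsOpen M) (hMne : M.Nonempty)
    (α : Fin (2 * (n - k)) → Form (2 * n) 1)
    (hα : ∀ i, IsFormOn (α i) M)
    -- linear independence on an open dense subset U₁ of M
    (U₁ : Set (Pt (2 * n))) (hU₁o : IsOpen U₁) (hU₁M : U₁ ⊆ M) (hU₁d : M ⊆ closure U₁)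
    (hind : ∀ x ∈ U₁, LinearIndependent ℝ fun i => cov1 (α i) x)
    -- almost symplectic structure with f nonvanishing on an open dense U ⊆ M
    (ω₀ Λ₀ : Form (2 * n) 2) (hsymp : AlmostSymp ω₀ Λ₀ M)
    (U : Set (Pt (2 * n))) (hUo : IsOpen U) (hUM : U ⊆ M) (hUd : M ⊆ closure U)
    (hfne : ∀ x ∈ U, fAlpha Λ₀ α x ≠ 0)
    -- σ : section of ⋀²D° of maximal rank 2k on U (D generated by the X_{α_i})
    (σ : Form (2 * n) 2) (hσ : IsFormOn σ M)
    (hσD : ∀ i, ∀ x ∈ M, ∀ b, ∑ a, σ x ![a, b] * sharpV Λ₀ (cov1 (α i) x) x a = 0)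
    (hσrank : ∀ x ∈ U, Matrix.rank (mat2 σ x) = 2 * k) :
    -- Λ = Λ₀^#(σ) has rank at most 2k …
    (∀ x ∈ M, Matrix.rank (mat2 (sharpF Λ₀ 2 σ) x) ≤ 2 * k) ∧
    -- … the α_i lie in its kernel …
    (∀ i, ∀ x ∈ M, ∀ b, ∑ a, sharpF Λ₀ 2 σ x ![a, b] * cov1 (α i) x a = 0) ∧
    -- … on U the kernel is exactly the span of α₁,…,α_{2(n-k)} …
    (∀ x ∈ U, ∀ β : Fin (2 * n) → ℝ,
        (∀ b, ∑ a, sharpF Λ₀ 2 σ x ![a, b] * β a = 0) ↔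
          β ∈ Submodule.span ℝ (Set.range fun i => cov1 (α i) x)) ∧
    -- … and its bracket satisfies formula (14) on U:
    (∀ h₁ h₂ : Pt (2 * n) → ℝ,
        ContDiffOn ℝ (⊤ : ℕ∞) h₁ M → ContDiffOn ℝ (⊤ : ℕ∞) h₂ M →
        ∀ x ∈ U, ∀ I : Fin (2 * n) → Fin (2 * n),
        braF (sharpF Λ₀ 2 σ) h₁ h₂ x * volF n ω₀ x I
          = -(fAlpha Λ₀ α x)⁻¹ *
            castF (by omega)
              (wedgeF 2 (2 + 2 * (k - 2) + 2 * (n - k))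
                (wedgeF 1 1 (dF h₁) (dF h₂)) (coreFormA k ω₀ Λ₀ σ α)) x I) := by
  have hskew : ∀ (ω : Form (2 * n) 2), IsFormOn ω M → ∀ x ∈ M,
      (mat2 ω x).transpose = -mat2 ω x := fun ω h x hx => (h.1 x hx).skew.transpose_mat2
  have hLW : ∀ x ∈ M, mat2 Λ₀ x * mat2 ω₀ x = -1 := by
    intro x hx
    have h := hsymp.2.2 x hx
    rw [← neg_eq_iff_eq_neg, ← mul_neg]
    exact mul_eq_one_comm.mp (by rw [neg_mul, h, neg_neg])
  have hdet : ∀ x ∈ M, IsUnit (mat2 Λ₀ x).det := fun x hx =>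
    isUnit_det_of_mul_eq_neg_one (hLW x hx)
  have hker : ∀ x ∈ M, ∀ i,
      Matrix.vecMul (Matrix.vecMul (cov1 (α i) x) (mat2 Λ₀ x)) (mat2 σ x) = 0 := by
    intro x hx i
    rw [← vecMul_mat2_eq_zero_iff, ← sharpV_eq]
    exact hσD i x hx
  have hker' : ∀ x ∈ M, ∀ i,
      Matrix.vecMul (cov1 (α i) x) (mat2 (sharpF Λ₀ 2 σ) x) = 0 := by
    intro x hx i
    rw [mat2_sharpF, hskew Λ₀ hsymp.2.1 x hx, ← Matrix.vecMul_vecMul, ← Matrix.vecMul_vecMul,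
      Matrix.vecMul_neg, Matrix.neg_vecMul, hker x hx i, neg_zero, Matrix.zero_vecMul]
  refine ⟨fun x hx => ?_, fun i x hx => ?_, fun x hx β => ?_, fun h₁ h₂ _ _ x hx I => ?_⟩
  · rw [rank_mat2_sharpF (hdet x hx)]
    exact rank_le_of_mem_closure hMo hUd (fun I => (hσ.2 I).continuousOn)
      (fun y hy => (hσrank y hy).le) hx
  · exact (vecMul_mat2_eq_zero_iff _ x _).mpr (hker' x hx i)
  · rw [vecMul_mat2_eq_zero_iff, ← ker_eq_span (linearIndependent_of_fAlpha_ne_zero (hfne x hx))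
      (hker' x (hUM hx)) (by
        rw [rank_mat2_sharpF (hdet x (hUM hx)), hσrank x hx]
        omega)]
    rfl
  · have hxM := hUM hx
    have hL := hskew Λ₀ hsymp.2.1 x hxM
    have hA := adapted_of_fAlpha_ne_zero (by omega) hkn (hskew ω₀ hsymp.1 x hxM) hL
      (hskew σ hσ x hxM) (hLW x hxM) (hfne x hx) (hker x hxM)
    exact bracket_formula hk hkn hL hA (hfne x hx) h₁ h₂ _ I

end
end Damianou
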